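/- Let β, μ ∈ ℝ with 0 < β − 1 < μ and let f ∈ L¹(ℝ;ℂ). Then S_{β,μ}f ∈ L¹(ℝ;ℂ), and the Fourier transform intertwines the generalized Stieltjes operators: for almost every x ∈ ℝ, the Fourier transform of S_{β,μ}f at x equals S_{μ−β+1,μ}(f̂)(x), where f̂ is the Fourier transform of f. -/

import Mathlib

open MeasureTheory

/-- The generalized Stieltjes operator `S_{β,μ}` on the real line. -/
noncomputable def SR (β μ : ℝ) (f : ℝ → ℂ) (t : ℝ) : ℂ :=
  if 0 < t then
    ((|t| ^ (μ - β) : ℝ) : ℂ) *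
      ∫ s in Set.Ioi (0 : ℝ), ((s ^ (β - 1) * (t + s) ^ (-μ) : ℝ) : ℂ) * f s
  else if t < 0 then
    ((|t| ^ (μ - β) : ℝ) : ℂ) *
      ∫ s in Set.Iio (0 : ℝ), ((|s| ^ (β - 1) * |t + s| ^ (-μ) : ℝ) : ℂ) * f s
  else 0

/-- The Fourier transform `ĝ(ξ) = ∫ e^{-iξt} g(t) dt`. -/
noncomputable def FT (g : ℝ → ℂ) (ξ : ℝ) : ℂ :=
  ∫ t : ℝ, Complex.exp (-(Complex.I * ξ * t)) * g t

/-- The one-variable kernel. -/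
noncomputable def kk (b m u : ℝ) : ℝ := u ^ (b - 1) * (1 + u) ^ (-m)

lemma SR_pos (b m : ℝ) (f : ℝ → ℂ) (t : ℝ) (ht : 0 < t) :
    SR b m f t = ∫ u in Set.Ioi (0 : ℝ), (kk b m u : ℂ) * f (t * u) := by
  have h := integral_comp_mul_left_Ioi
    (fun s => ((s ^ (b - 1) * (t + s) ^ (-m) : ℝ) : ℂ) * f s) 0 ht
  rw [mul_zero] at h
  have h2 : (∫ s in Set.Ioi (0 : ℝ), ((s ^ (b - 1) * (t + s) ^ (-m) : ℝ) : ℂ) * f s)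
      = (t : ℂ) * ∫ x in Set.Ioi (0 : ℝ),
        (((t * x) ^ (b - 1) * (t + t * x) ^ (-m) : ℝ) : ℂ) * f (t * x) := by
    rw [h, Complex.real_smul, ← mul_assoc, Complex.ofReal_inv, mul_inv_cancel₀, one_mul]
    exact_mod_cast ht.ne'
  rw [SR, if_pos ht, h2, ← mul_assoc, ← integral_const_mul]
  apply setIntegral_congr_fun measurableSet_Ioi
  intro u hu
  have hu : 0 < u := hu
  simp only
  rw [← mul_assoc]
  congr 1
  rw [← Complex.ofReal_mul, ← Complex.ofReal_mul]
  congr 1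
  have e : t + t * u = t * (1 + u) := by ring
  rw [kk, e, Real.mul_rpow ht.le hu.le, Real.mul_rpow ht.le (by positivity), abs_of_pos ht]
  have : t ^ (m - b) * t * (t ^ (b - 1) * t ^ (-m)) = 1 := by
    nth_rewrite 2 [← Real.rpow_one t]
    rw [← Real.rpow_add ht, ← Real.rpow_add ht, ← Real.rpow_add ht]
    ring_nf
    simp
  linear_combination (u ^ (b - 1) * (1 + u) ^ (-m)) * this

lemma SR_neg (b m : ℝ) (f : ℝ → ℂ) (t : ℝ) (ht : 0 < t) :
    SR b m f (-t) = SR b m (fun s => f (-s)) t := by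
  rw [SR, SR, if_neg (by linarith), if_pos (by linarith), if_pos ht, abs_neg]
  congr 1
  rw [← integral_Iic_eq_integral_Iio]
  have h := integral_comp_neg_Ioi (0:ℝ)
    (fun s => ((|s| ^ (b - 1) * |-t + s| ^ (-m) : ℝ) : ℂ) * f s)
  rw [neg_zero] at h
  rw [← h]
  apply setIntegral_congr_fun measurableSet_Ioi
  intro u hu
  have hu : 0 < u := hu
  have e : -t + -u = -(t + u) := by ring
  simp only
  rw [e, abs_neg, abs_neg, abs_of_pos hu, abs_of_pos (by positivity)]

lemma SR_eq (b m : ℝ) (f : ℝ → ℂ) (t : ℝ) (ht : t ≠ 0) :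
    SR b m f t = ∫ u in Set.Ioi (0 : ℝ), (kk b m u : ℂ) * f (t * u) := by
  rcases lt_or_gt_of_ne ht with h | h
  · have := SR_neg b m f (-t) (by linarith)
    rw [neg_neg] at this
    rw [this, SR_pos _ _ _ _ (by linarith)]
    simp
  · exact SR_pos b m f t h

lemma SR_congr (b m : ℝ) (f g : ℝ → ℂ) (h : f =ᵐ[volume] g) : SR b m f = SR b m g := by
  funext t
  have A : ∀ (s : Set ℝ) (w : ℝ → ℂ), ∫ x in s, w x * f x = ∫ x in s, w x * g x := by
    intro s w
    apply integral_congr_ae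
    filter_upwards [ae_restrict_of_ae h] with x hx
    rw [hx]
  unfold SR
  rw [A, A]

lemma FT_congr (f g : ℝ → ℂ) (h : f =ᵐ[volume] g) : FT f = FT g := by
  funext t
  apply integral_congr_ae
  filter_upwards [h] with x hx
  rw [hx]

lemma kk_meas (b m : ℝ) : Measurable (kk b m) := by
  unfold kk
  fun_prop

lemma kk_int (b m : ℝ) (h1 : 0 < b - 1) (h2 : b - 1 < m) :
    IntegrableOn (fun u => kk b m u * u⁻¹) (Set.Ioi 0) := by
  have hm := kk_meas b m
  rw [← Set.Ioc_union_Ioi_eq_Ioi (zero_le_one' ℝ)]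
  apply IntegrableOn.union
  · have : IntegrableOn (fun u : ℝ => u ^ (b - 2)) (Set.Ioc 0 1) :=
      (intervalIntegral.intervalIntegrable_rpow' (by linarith) (a := 0) (b := 1)).1
    refine Integrable.mono' this (by fun_prop) ?_
    filter_upwards [ae_restrict_mem measurableSet_Ioc] with u hu
    have hu0 : 0 < u := hu.1
    have e : u ^ (b - 1) * u⁻¹ = u ^ (b - 2) := by
      rw [← Real.rpow_neg_one, ← Real.rpow_add hu0]; ring_nf
    have : (1 + u) ^ (-m) ≤ 1 :=
      Real.rpow_le_one_of_one_le_of_nonpos (by linarith) (by linarith)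
    rw [kk, Real.norm_of_nonneg (by positivity), ← e]
    calc _ = u ^ (b - 1) * u⁻¹ * (1 + u) ^ (-m) := by ring
      _ ≤ u ^ (b - 1) * u⁻¹ * 1 := by gcongr
      _ = _ := by ring
  · have : IntegrableOn (fun u : ℝ => u ^ (b - 2 - m)) (Set.Ioi 1) :=
      integrableOn_Ioi_rpow_of_lt (by linarith) one_pos
    refine Integrable.mono' this (by fun_prop) ?_
    filter_upwards [ae_restrict_mem measurableSet_Ioi] with u hu
    have hu0 : 0 < u := lt_trans one_pos hu
    have e : u ^ (b - 1) * u⁻¹ * u ^ (-m) = u ^ (b - 2 - m) := by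
      rw [← Real.rpow_neg_one, ← Real.rpow_add hu0, ← Real.rpow_add hu0]; ring_nf
    have : (1 + u) ^ (-m) ≤ u ^ (-m) :=
      Real.rpow_le_rpow_of_nonpos hu0 (by linarith) (by linarith)
    rw [kk, Real.norm_of_nonneg (by positivity), ← e]
    calc _ = u ^ (b - 1) * u⁻¹ * (1 + u) ^ (-m) := by ring
      _ ≤ u ^ (b - 1) * u⁻¹ * u ^ (-m) := by gcongr

lemma prod_int (b m : ℝ) (h1 : 0 < b - 1) (h2 : b - 1 < m) (f : ℝ → ℂ)
    (hf : Integrable f) (hm : StronglyMeasurable f) :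
    Integrable (fun p : ℝ × ℝ => (kk b m p.1 : ℂ) * f (p.2 * p.1))
      ((volume.restrict (Set.Ioi 0)).prod volume) := by
  have hk := kk_meas b m
  have hm' := hm.measurable
  rw [integrable_prod_iff (Measurable.aestronglyMeasurable (by fun_prop))]
  constructor
  · filter_upwards [ae_restrict_mem measurableSet_Ioi] with u hu
    exact (hf.comp_mul_right' (ne_of_gt hu)).const_mul _
  · refine ((kk_int b m h1 h2).mul_const (∫ t, ‖f t‖)).congr ?_
    filter_upwards [ae_restrict_mem measurableSet_Ioi] with u hu
    have hu0 : 0 < u := hu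
    have hk0 : 0 ≤ kk b m u := by unfold kk; positivity
    simp only [norm_mul, Complex.norm_real]
    rw [integral_const_mul, Measure.integral_comp_mul_right (fun t => ‖f t‖),
      Real.norm_of_nonneg hk0, abs_of_pos (by positivity), smul_eq_mul, mul_assoc]

lemma main_meas (β μ : ℝ) (h1 : 0 < β - 1) (h2 : β - 1 < μ)
    (f : ℝ → ℂ) (hf : Integrable f) (hm : StronglyMeasurable f) :
    Integrable (SR β μ f) ∧
    ∀ᵐ x : ℝ, FT (SR β μ f) x = SR (μ - β + 1) μ (FT f) x := by
  have hP := prod_int β μ h1 h2 f hf hm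
  have h0 : ∀ᵐ t : ℝ, t ≠ 0 := by simp [ae_iff]
  constructor
  · refine hP.integral_prod_right.congr ?_
    filter_upwards [h0] with t ht
    rw [SR_eq _ _ _ _ ht]
  · filter_upwards [h0] with x hx
    have hQ : Integrable (fun p : ℝ × ℝ => Complex.exp (-(Complex.I * x * p.2)) *
        ((kk β μ p.1 : ℂ) * f (p.2 * p.1)))
        ((volume.restrict (Set.Ioi 0)).prod volume) := by
      refine hP.bdd_mul (c := 1) (Measurable.aestronglyMeasurable (by fun_prop)) ?_
      filter_upwards with p
      rw [Complex.norm_exp]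
      simp
    have e1 : FT (SR β μ f) x = ∫ t : ℝ, ∫ u in Set.Ioi (0:ℝ),
        Complex.exp (-(Complex.I * x * t)) * ((kk β μ u : ℂ) * f (t * u)) := by
      apply integral_congr_ae
      filter_upwards [h0] with t ht
      rw [SR_eq _ _ _ _ ht, integral_const_mul]
    rw [e1, ← integral_integral_swap hQ, SR_eq _ _ _ _ hx,
      ← integral_comp_rpow_Ioi (fun v => (kk (μ - β + 1) μ v : ℂ) * FT f (x * v)) (show (-1 : ℝ) ≠ 0 by norm_num)]
    apply setIntegral_congr_fun measurableSet_Ioi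
    intro u hu
    have hu0 : 0 < u := hu
    simp only
    have e2 : (∫ t : ℝ, Complex.exp (-(Complex.I * x * t)) * ((kk β μ u : ℂ) * f (t * u)))
        = (kk β μ u : ℂ) * ((u⁻¹ : ℝ) * FT f (x * u⁻¹)) := by
      have := Measure.integral_comp_mul_right
        (fun t : ℝ => Complex.exp (-(Complex.I * (x * u⁻¹ : ℝ) * t)) * f t) u
      rw [abs_of_pos (by positivity), Complex.real_smul] at this
      rw [FT, ← this, ← integral_const_mul]
      congr 1
      funext t
      have hu' : (u : ℂ) ≠ 0 := by exact_mod_cast hu0.ne'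
      have : Complex.I * ((x * u⁻¹ : ℝ) : ℂ) * ((t * u : ℝ) : ℂ) = Complex.I * x * t := by
        push_cast
        field_simp
      rw [this]
      ring
    rw [e2, Real.rpow_neg_one, Complex.real_smul, ← mul_assoc, ← mul_assoc, ← Complex.ofReal_mul,
      ← Complex.ofReal_mul]
    congr 2
    have e3 : 1 + u⁻¹ = (1 + u) * u⁻¹ := by field_simp; ring
    rw [kk, kk, e3, Real.mul_rpow (by positivity) (by positivity), ← Real.rpow_neg_one,
      ← Real.rpow_mul hu0.le, ← Real.rpow_mul hu0.le]
    have e4 : u ^ (-1 - 1 : ℝ) * (u ^ (-1 * (μ - β + 1 - 1)) * u ^ (-1 * -μ))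
        = u ^ (β - 1) * u ^ (-1 : ℝ) := by
      rw [← Real.rpow_add hu0, ← Real.rpow_add hu0, ← Real.rpow_add hu0]
      ring_nf
    rw [abs_neg, abs_one]
    linear_combination (-(1 + u) ^ (-μ)) * e4

theorem stmt19 (β μ : ℝ) (h1 : 0 < β - 1) (h2 : β - 1 < μ)
    (f : ℝ → ℂ) (hf : Integrable f) :
    Integrable (SR β μ f) ∧
    ∀ᵐ x : ℝ, FT (SR β μ f) x = SR (μ - β + 1) μ (FT f) x := by
  have hae := hf.1.ae_eq_mk
  rw [SR_congr β μ _ _ hae, FT_congr _ _ hae]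
  exact main_meas β μ h1 h2 _ (hf.congr hae) hf.1.stronglyMeasurable_mk
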